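/- arXiv:0712.3857 — 2 statements merged into one kernel-verified Lean document; each statement's English description precedes it below -/
import Mathlib

section
/- Let G be a finite group and k a commutative ring, and let Δ : k[G] → k[G] ⊗_k k[G] be the k-linear map determined on group elements by Δ(g) = Σ_{(h,h′) ∈ G×G, hh′ = g} h ⊗ h′. Then for all a, b ∈ k[G] the Frobenius compatibility holds: Δ(a·b) = (a ⊗ 1)·Δ(b) = Δ(a)·(1 ⊗ b), where the products on the right-hand sides are taken in the tensor product algebra k[G] ⊗_k k[G]. -/
open scoped TensorProduct

/-- Let `G` be a finite group, `k` a commutative ring, and let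
`Δ : k[G] → k[G] ⊗ₖ k[G]` be the `k`-linear map determined on group elements by
`Δ(g) = ∑_{(h,h') ∈ G×G, h h' = g} h ⊗ h'`.  Then for all `a, b ∈ k[G]` the Frobenius
compatibility holds: `Δ(a·b) = (a ⊗ 1)·Δ(b) = Δ(a)·(1 ⊗ b)`, products on the right
being taken in the tensor product algebra `k[G] ⊗ₖ k[G]`. -/
theorem statement6 (k : Type*) [CommRing k] (G : Type*) [Group G] [Fintype G]
    [DecidableEq G]
    (Δ : MonoidAlgebra k G →ₗ[k] MonoidAlgebra k G ⊗[k] MonoidAlgebra k G)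
    (hΔ : ∀ g : G,
      Δ (MonoidAlgebra.of k G g) =
        ∑ p ∈ Finset.univ.filter (fun p : G × G => p.1 * p.2 = g),
          MonoidAlgebra.of k G p.1 ⊗ₜ[k] MonoidAlgebra.of k G p.2) :
    ∀ a b : MonoidAlgebra k G,
      Δ (a * b) = (a ⊗ₜ[k] (1 : MonoidAlgebra k G)) * Δ b ∧
      Δ (a * b) = Δ a * ((1 : MonoidAlgebra k G) ⊗ₜ[k] b) := by
  intro a b
  induction a using MonoidAlgebra.induction_on with
  | of g =>
    induction b using MonoidAlgebra.induction_on with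
    | of h =>
      rw [← map_mul, hΔ, hΔ, hΔ, Finset.mul_sum, Finset.sum_mul]
      constructor
      · refine (Finset.sum_equiv ((Equiv.mulLeft g).prodCongr (Equiv.refl G)) ?_ ?_).symm
        · simp [mul_assoc]
        · simp [MonoidAlgebra.single_mul_single]
      · refine (Finset.sum_equiv ((Equiv.refl G).prodCongr (Equiv.mulRight h)) ?_ ?_).symm
        · simp [← mul_assoc]
        · simp [MonoidAlgebra.single_mul_single]
    | add x y hx hy =>
      simp only [mul_add, map_add, TensorProduct.tmul_add]
      exact ⟨congrArg₂ (· + ·) hx.1 hy.1, congrArg₂ (· + ·) hx.2 hy.2⟩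
    | smul r x hx =>
      simp only [mul_smul_comm, map_smul, TensorProduct.tmul_smul]
      exact ⟨congrArg (r • ·) hx.1, congrArg (r • ·) hx.2⟩
  | add x y hx hy =>
    simp only [add_mul, map_add, TensorProduct.add_tmul]
    exact ⟨congrArg₂ (· + ·) hx.1 hy.1, congrArg₂ (· + ·) hx.2 hy.2⟩
  | smul r x hx =>
    simp only [smul_mul_assoc, map_smul, ← TensorProduct.smul_tmul']
    exact ⟨congrArg (r • ·) hx.1, congrArg (r • ·) hx.2⟩
end

section
/- Let G be a finite group and k a commutative ring, and let Δ : k[G] → k[G] ⊗_k k[G] be the k-linear map determined on group elements by Δ(g) = Σ_{(h,h′) ∈ G×G, hh′ = g} h ⊗ h′. Then for every element z in the center of the group algebra k[G], the image of Δ(z) under the flip map a ⊗ b ↦ b ⊗ a of k[G] ⊗_k k[G] equals Δ(z); that is, Δ is cocommutative on central elements. -/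
open scoped TensorProduct

theorem MonoidAlgebra.coeff_mul_comm_of_mem_center {k G : Type*} [CommRing k] [Group G]
    {z : MonoidAlgebra k G} (hz : z ∈ Set.center (MonoidAlgebra k G)) (a b : G) :
    z.coeff (a * b) = z.coeff (b * a) := by
  have h := (Set.mem_center_iff.mp hz).comm (MonoidAlgebra.single a 1)
  have h' := congrArg (fun x => x.coeff (a * b * a)) h.eq
  simpa [MonoidAlgebra.coeff_mul_single_apply, MonoidAlgebra.coeff_single_mul_apply,
    mul_assoc] using h'

theorem MonoidAlgebra.map_eq_sum_coeff_mul_smul_tmul {k G : Type*} [CommRing k] [Group G]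
    [Fintype G] [DecidableEq G]
    (Δ : MonoidAlgebra k G →ₗ[k] MonoidAlgebra k G ⊗[k] MonoidAlgebra k G)
    (hΔ : ∀ g : G,
      Δ (MonoidAlgebra.of k G g) =
        ∑ p ∈ Finset.univ.filter (fun p : G × G => p.1 * p.2 = g),
          MonoidAlgebra.of k G p.1 ⊗ₜ[k] MonoidAlgebra.of k G p.2)
    (x : MonoidAlgebra k G) :
    Δ x = ∑ p : G × G, x.coeff (p.1 * p.2) •
      (MonoidAlgebra.of k G p.1 ⊗ₜ[k] MonoidAlgebra.of k G p.2) := by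
  induction x using MonoidAlgebra.induction_on with
  | of g =>
    rw [hΔ, Finset.sum_filter]
    refine Finset.sum_congr rfl fun p _ => ?_
    by_cases h : p.1 * p.2 = g <;> simp [MonoidAlgebra.of_apply, h]
  | add x y hx hy => simp [hx, hy, add_smul, Finset.sum_add_distrib]
  | smul r x hx => simp [hx, Finset.smul_sum, smul_smul]

/-- Let `G` be a finite group, `k` a commutative ring, and let
`Δ : k[G] → k[G] ⊗ₖ k[G]` be the `k`-linear map determined on group elements by
`Δ(g) = ∑_{(h,h') ∈ G×G, h h' = g} h ⊗ h'`.  Then for every `z` in the center of the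
group algebra `k[G]`, the image of `Δ(z)` under the flip `a ⊗ b ↦ b ⊗ a` equals
`Δ(z)`; that is, `Δ` is cocommutative on central elements. -/
theorem statement7 (k : Type*) [CommRing k] (G : Type*) [Group G] [Fintype G]
    [DecidableEq G]
    (Δ : MonoidAlgebra k G →ₗ[k] MonoidAlgebra k G ⊗[k] MonoidAlgebra k G)
    (hΔ : ∀ g : G,
      Δ (MonoidAlgebra.of k G g) =
        ∑ p ∈ Finset.univ.filter (fun p : G × G => p.1 * p.2 = g),
          MonoidAlgebra.of k G p.1 ⊗ₜ[k] MonoidAlgebra.of k G p.2) :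
    ∀ z ∈ Set.center (MonoidAlgebra k G),
      TensorProduct.comm k (MonoidAlgebra k G) (MonoidAlgebra k G) (Δ z) = Δ z := by
  intro z hz
  rw [MonoidAlgebra.map_eq_sum_coeff_mul_smul_tmul Δ hΔ z, map_sum]
  refine Fintype.sum_equiv (Equiv.prodComm G G) _ _ fun p => ?_
  simp [MonoidAlgebra.coeff_mul_comm_of_mem_center hz p.1 p.2]
end
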